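/- arXiv:1003.4866 — 4 statements merged into one kernel-verified Lean document; each statement's English description precedes it below -/
import Mathlib

section
/- There exist infinitely many binary strings w (i.e., binary strings of arbitrarily large length) such that the sum of the exponents of all runs in w is strictly greater than 2.035·|w|. -/
open scoped Classical

namespace RunsExp

variable {α : Type*}

/-- `p` is a period of the word `w`. -/
def IsPeriod (w : List α) (p : ℕ) : Prop :=
  0 < p ∧ ∀ i : ℕ, i + p < w.length → w[i]? = w[i + p]?

/-- The shortest period of the word `w`. -/
noncomputable def minPeriod (w : List α) : ℕ := sInf {p | IsPeriod w p}

/-- The factor `u[i..j]` of `u` (0-based indices, inclusive on both ends). -/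
def factor (u : List α) (i j : ℕ) : List α := (u.drop i).take (j - i + 1)

/-- `[i..j]` is a run in `u` (0-based indices): the shortest period `p` of `u[i..j]`
satisfies `2p ≤ j-i+1` and the interval can be extended neither to the left nor to
the right without violating this property. -/
def IsRun (u : List α) (i j : ℕ) : Prop :=
  i ≤ j ∧ j < u.length ∧
  2 * minPeriod (factor u i j) ≤ j - i + 1 ∧
  (i = 0 ∨ u[i - 1]? ≠ u[i + minPeriod (factor u i j) - 1]?) ∧
  (j = u.length - 1 ∨ u[j - minPeriod (factor u i j) + 1]? ≠ u[j + 1]?)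

/-- The exponent of the run `[i..j]` of `u`. -/
noncomputable def exponent (u : List α) (i j : ℕ) : ℚ :=
  ((j : ℚ) - (i : ℚ) + 1) / (minPeriod (factor u i j) : ℚ)

/-- The set of all runs of `u`, as a finset of pairs of indices. -/
noncomputable def runs (u : List α) : Finset (ℕ × ℕ) :=
  (Finset.range u.length ×ˢ Finset.range u.length).filter fun q => IsRun u q.1 q.2

/-- The sum of exponents of all runs in `u`. -/
noncomputable def sigma (u : List α) : ℚ :=
  ∑ q ∈ runs u, exponent u q.1 q.2

/-- The lexicographically minimal word cyclically equivalent to `w`. -/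
noncomputable def minRot [LinearOrder α] (w : List α) : List α :=
  ((List.range w.length).map w.rotate).foldr min w

/-- The lexicographically maximal word cyclically equivalent to `w`. -/
noncomputable def maxRot [LinearOrder α] (w : List α) : List α :=
  ((List.range w.length).map w.rotate).foldr max w

/-- The word `x` occurs in `u` at (0-based) starting position `s`, entirely within
the interval `[i..j]`. -/
def OccursAt (u : List α) (i j : ℕ) (x : List α) (s : ℕ) : Prop :=
  i ≤ s ∧ s + x.length ≤ j + 1 ∧ factor u s (s + x.length - 1) = x

/-- `s` and `s'` are starting positions of consecutive occurrences of `x`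
inside the interval `[i..j]` of `u`. -/
def ConsecutiveOcc (u : List α) (i j : ℕ) (x : List α) (s s' : ℕ) : Prop :=
  OccursAt u i j x s ∧ OccursAt u i j x s' ∧ s < s' ∧
    ∀ t, s < t → t < s' → ¬ OccursAt u i j x t

/-- The set of handles of the run `[i..j]` of `u`: inter-position `k` lies between
the letters at positions `k` and `k+1`.  If the minimal and maximal rotations of the
period-prefix `w` coincide, all inter-positions inside the run are handles; otherwise
the handles are the inter-positions between consecutive occurrences of the minimal
rotation and between consecutive occurrences of the maximal rotation. -/
noncomputable def handles [LinearOrder α] (u : List α) (i j : ℕ) : Set ℕ :=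
  let p := minPeriod (factor u i j)
  let w := factor u i (i + p - 1)
  if minRot w = maxRot w then
    {k | i ≤ k ∧ k < j}
  else
    {k | ∃ s s', (ConsecutiveOcc u i j (minRot w) s s' ∨
                  ConsecutiveOcc u i j (maxRot w) s s') ∧ k = s' - 1}

/-- `[i..j]` is a cubic run in `u`. -/
def IsCubicRun (u : List α) (i j : ℕ) : Prop :=
  IsRun u i j ∧ 3 * minPeriod (factor u i j) ≤ j - i + 1

/-- The set of all cubic runs of `u`. -/
noncomputable def cubicRuns (u : List α) : Finset (ℕ × ℕ) :=
  (Finset.range u.length ×ˢ Finset.range u.length).filter fun q => IsCubicRun u q.1 q.2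

/-- The sum of exponents of all cubic runs in `u`. -/
noncomputable def sigmaCubic (u : List α) : ℚ :=
  ∑ q ∈ cubicRuns u, exponent u q.1 q.2




/-- The repeated block of length 636, as the bits of a number. -/
def W : ℕ := 239025434019418711144410547457677258854605261659983285181836625012453154834234019787945243710445689161774770050007703885205305482767486417158149996028499239285286933421247680423725677343890130

def Ps : List ℕ := [1, 2, 3, 5, 8, 13, 18, 21, 31, 34, 44, 52, 65, 96, 109, 161, 205, 270, 366]

/-- `k` copies of the block, as a number. -/
def rep : ℕ → ℕ
  | 0 => 0
  | k + 1 => (rep k <<< 636) ||| W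

/-- The check that a run of period `p` and length `g + p` starts at bit 1 of `z`. -/
def ok (y p g : ℕ) : Bool :=
  Nat.testBit y 0 && ((y >>> 1) % 2 ^ g == 0) && Nat.testBit y (g + 1) &&
    Nat.ble p g && Nat.ble (g + p) 1272 && Nat.ble 1 p

/-- Number of trailing zeros. -/
def tz (y : ℕ) : ℕ := Nat.log2 (y ^^^ (y - 1))

/-- Scaled sum of the exponents of the runs starting at bit 1 of `z`. -/
def row (z : ℕ) : List ℕ → ℕ → ℕ
  | [], _ => 0
  | p :: ps, last =>
    let g := tz ((z ^^^ (z >>> p)) >>> 1)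
    cond (ok (z ^^^ (z >>> p)) p g && Nat.blt last (g + p))
      (1000000 * (g + p) / p + row z ps (g + p))
      (row z ps last)

def total (V : ℕ) : ℕ → ℕ
  | 0 => 0
  | i + 1 => total V i + row (V >>> (i + 635)) Ps 0

lemma total_ge : Nat.ble 1295600000 (total (rep 4) 636) = true := by
  decide +kernel

lemma W_lt : W < 2 ^ 636 := by
  decide +kernel

/-- The infinite periodic word. -/
def U (x : ℕ) : Bool := W.testBit (x % 636)

lemma U_add (x t : ℕ) : U (x + 636 * t) = U x := by
  simp [U]

lemma rep_testBit (k x : ℕ) (h : x < 636 * k) : (rep k).testBit x = U x := by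
  induction k generalizing x with
  | zero => omega
  | succ k ih =>
    rw [rep, Nat.testBit_or, Nat.testBit_shiftLeft]
    by_cases hx : 636 ≤ x
    · have h1 : W.testBit x = false :=
        Nat.testBit_lt_two_pow (lt_of_lt_of_le W_lt (Nat.pow_le_pow_right (by norm_num) hx))
      rw [ih (x - 636) (by omega), h1]
      simp only [hx, decide_true, Bool.true_and, Bool.or_false]
      rw [← U_add (x - 636) 1]
      congr 1
      omega
    · have : x % 636 = x := Nat.mod_eq_of_lt (by omega)
      simp [hx, U, this]

lemma factor_length (u : List α) (i len : ℕ) (h0 : 0 < len) (h : i + len ≤ u.length) :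
    (factor u i (i + len - 1)).length = len := by
  simp [factor]; omega

lemma factor_get (u : List α) (i len x : ℕ) (hx : x < len) :
    (factor u i (i + len - 1))[x]? = u[i + x]? := by
  rw [factor, List.getElem?_take_of_lt (by omega), List.getElem?_drop]

lemma run_of (u : List α) (i len p : ℕ) (hp : 0 < p) (h2 : 2 * p ≤ len)
    (hlen : i + len < u.length) (hi : 1 ≤ i)
    (per : ∀ x, i ≤ x → x + p < i + len → u[x]? = u[x + p]?)
    (left : u[i - 1]? ≠ u[i - 1 + p]?)
    (right : u[i + len - p]? ≠ u[i + len]?) :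
    IsRun u i (i + len - 1) ∧ (len / p : ℚ) ≤ exponent u i (i + len - 1) := by
  have hL := factor_length u i len (by omega) (by omega)
  have hP : IsPeriod (factor u i (i + len - 1)) p := by
    refine ⟨hp, fun x hx => ?_⟩
    rw [hL] at hx
    rw [factor_get u i len x (by omega), factor_get u i len (x + p) hx, ← add_assoc]
    exact per (i + x) (by omega) (by omega)
  have hq : IsPeriod (factor u i (i + len - 1)) (minPeriod (factor u i (i + len - 1))) :=
    Nat.sInf_mem (s := {p | IsPeriod (factor u i (i + len - 1)) p}) ⟨p, hP⟩
  have hqp : minPeriod (factor u i (i + len - 1)) ≤ p :=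
    Nat.sInf_le (s := {p | IsPeriod (factor u i (i + len - 1)) p}) hP
  unfold IsRun exponent
  generalize minPeriod (factor u i (i + len - 1)) = q at hq hqp
  obtain ⟨hq0, hq⟩ := hq
  have hq' : ∀ x, i ≤ x → x + q < i + len → u[x]? = u[x + q]? := by
    intro x h1 h3
    have := hq (x - i) (by omega)
    rw [factor_get u i len _ (by omega), factor_get u i len _ (by omega)] at this
    rwa [show i + (x - i) = x by omega, show i + (x - i + q) = x + q by omega] at this
  refine ⟨⟨by omega, by omega, by omega, Or.inr ?_, Or.inr ?_⟩, ?_⟩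
  · intro h
    apply left
    rw [h]
    have e1 := per (i + q - 1) (by omega) (by omega)
    have e2 := hq' (i - 1 + p) (by omega) (by omega)
    rw [e1, e2]
    congr 1
    omega
  · intro h
    apply right
    rw [show i + len - 1 + 1 = i + len by omega] at h
    rw [← h]
    have e1 := per (i + len - q - p) (by omega) (by omega)
    have e2 := hq' (i + len - q - p) (by omega) (by omega)
    rw [show i + len - q - p + p = i + len - q by omega] at e1
    rw [show i + len - q - p + q = i + len - p by omega] at e2
    rw [← e2, e1]
    congr 1
    omega
  · have : (((i + len - 1 : ℕ) : ℚ) - (i : ℚ) + 1) = len := by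
      rw [Nat.cast_sub (by omega)]; push_cast; ring
    rw [this]
    have h3 : (0 : ℚ) < q := by exact_mod_cast hq0
    have h4 : (q : ℚ) ≤ p := by exact_mod_cast hqp
    gcongr

/-- The exponent of the run at `i` with length `len`, or zero. -/
noncomputable def Ex (u : List α) (i len : ℕ) : ℚ :=
  if IsRun u i (i + len - 1) then exponent u i (i + len - 1) else 0

lemma exponent_nonneg (u : List α) (i j : ℕ) (h : i ≤ j) : 0 ≤ exponent u i j := by
  unfold exponent
  have : (i : ℚ) ≤ j := by exact_mod_cast h
  apply div_nonneg
  · linarith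
  · positivity

lemma Ex_nonneg (u : List α) (i len : ℕ) : 0 ≤ Ex u i len := by
  unfold Ex
  split_ifs with h
  · exact exponent_nonneg _ _ _ h.1
  · exact le_rfl

/-- The finite word: `k` copies of the block. -/
def wrd (k : ℕ) : List Bool := (List.range (636 * k)).map U

lemma wrd_length (k : ℕ) : (wrd k).length = 636 * k := by simp [wrd]

lemma wrd_get (k x : ℕ) (h : x < 636 * k) : (wrd k)[x]? = some (U x) := by
  simp [wrd, h]

lemma Ex_ge (k t i0 p g : ℕ) (ht : t + 4 ≤ k) (hi : i0 < 636)
    (h : ok ((rep 4 >>> (i0 + 635)) ^^^ ((rep 4 >>> (i0 + 635)) >>> p)) p g = true) :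
    (((g + p : ℕ) : ℚ) / p) ≤ Ex (wrd k) (636 * (t + 1) + i0) (g + p) := by
  simp only [ok, Bool.and_eq_true, Nat.ble_eq, beq_iff_eq] at h
  obtain ⟨⟨⟨⟨⟨h0, hz⟩, hg⟩, hpg⟩, hB⟩, hp⟩ := h
  have key : ∀ x, x + p ≤ g + p + 1 →
      ((rep 4 >>> (i0 + 635)) ^^^ ((rep 4 >>> (i0 + 635)) >>> p)).testBit x
        = ((U (636 * t + 635 + i0 + x)) ^^ (U (636 * t + 635 + i0 + x + p))) := by
    intro x hx
    rw [Nat.testBit_xor, Nat.testBit_shiftRight, Nat.testBit_shiftRight,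
      Nat.testBit_shiftRight, rep_testBit 4 _ (by omega), rep_testBit 4 _ (by omega)]
    rw [← U_add (i0 + 635 + x) t, ← U_add (i0 + 635 + (p + x)) t]
    congr 2 <;> omega
  have hmid : ∀ x, x < g →
      ((rep 4 >>> (i0 + 635)) ^^^ ((rep 4 >>> (i0 + 635)) >>> p)).testBit (1 + x) = false := by
    intro x hx
    rw [← Nat.testBit_shiftRight]
    have := Nat.testBit_mod_two_pow
      (((rep 4 >>> (i0 + 635)) ^^^ ((rep 4 >>> (i0 + 635)) >>> p)) >>> 1) g x
    rw [hz] at this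
    simpa [hx] using this.symm
  rw [key 0 (by omega)] at h0
  rw [key (g + 1) (by omega)] at hg
  have main := run_of (wrd k) (636 * (t + 1) + i0) (g + p) p (by omega) (by omega)
    (by rw [wrd_length]; omega) (by omega)
    (by
      intro x h1 h3
      rw [wrd_get k _ (by omega), wrd_get k _ (by omega)]
      have e := hmid (x - (636 * (t + 1) + i0)) (by omega)
      rw [key _ (by omega)] at e
      rw [show 636 * t + 635 + i0 + (1 + (x - (636 * (t + 1) + i0))) = x by omega] at e
      simpa using e)
    (by
      rw [wrd_get k _ (by omega), wrd_get k _ (by omega)]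
      rw [show 636 * (t + 1) + i0 - 1 = 636 * t + 635 + i0 + 0 by omega]
      simpa using h0)
    (by
      rw [wrd_get k _ (by omega), wrd_get k _ (by omega)]
      rw [show 636 * (t + 1) + i0 + (g + p) - p = 636 * t + 635 + i0 + (g + 1) by omega,
        show 636 * (t + 1) + i0 + (g + p) = 636 * t + 635 + i0 + (g + 1) + p by omega]
      simpa using hg)
  rw [Ex, if_pos main.1]
  exact main.2

lemma row_le (k t i0 : ℕ) (ht : t + 4 ≤ k) (hi : i0 < 636) (ps : List ℕ) (last : ℕ) :
    ((row (rep 4 >>> (i0 + 635)) ps last : ℕ) : ℚ) ≤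
      1000000 * ∑ len ∈ Finset.Ioc last 1272, Ex (wrd k) (636 * (t + 1) + i0) len := by
  induction ps generalizing last with
  | nil =>
    simp only [row, Nat.cast_zero]
    have := Finset.sum_nonneg (s := Finset.Ioc last 1272)
      (fun len _ => Ex_nonneg (wrd k) (636 * (t + 1) + i0) len)
    positivity
  | cons p ps ih =>
    rw [row]
    generalize tz ((rep 4 >>> (i0 + 635) ^^^ rep 4 >>> (i0 + 635) >>> p) >>> 1) = g
    cases hc : (ok ((rep 4 >>> (i0 + 635)) ^^^ ((rep 4 >>> (i0 + 635)) >>> p)) p g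
      && Nat.blt last (g + p))
    · simpa using ih last
    · rw [Bool.and_eq_true] at hc
      obtain ⟨hok, hl⟩ := hc
      have hE := Ex_ge k t i0 p g ht hi hok
      simp only [ok, Bool.and_eq_true, Nat.ble_eq] at hok
      have hB := hok.1.2
      have hl' : last < g + p := by simpa [Nat.blt] using hl
      have hsub : insert (g + p) (Finset.Ioc (g + p) 1272) ⊆ Finset.Ioc last 1272 := by
        intro x hx
        simp only [Finset.mem_insert, Finset.mem_Ioc] at hx ⊢
        omega
      have hs := Finset.sum_le_sum_of_subset_of_nonneg hsub
        (fun len _ _ => Ex_nonneg (wrd k) (636 * (t + 1) + i0) len)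
      rw [Finset.sum_insert (by simp)] at hs
      have hd : ((1000000 * (g + p) / p : ℕ) : ℚ) ≤ 1000000 * (((g + p : ℕ) : ℚ) / p) := by
        refine Nat.cast_div_le.trans ?_
        push_cast
        rw [mul_div_assoc]
      have := ih (g + p)
      simp only [cond_true, Nat.cast_add] at *
      linarith

lemma total_le (k t : ℕ) (ht : t + 4 ≤ k) (m : ℕ) (hm : m ≤ 636) :
    ((total (rep 4) m : ℕ) : ℚ) ≤
      1000000 * ∑ i0 ∈ Finset.range m, ∑ len ∈ Finset.Ioc 0 1272,
        Ex (wrd k) (636 * (t + 1) + i0) len := by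
  induction m with
  | zero => simp [total]
  | succ m ih =>
    rw [total, Finset.sum_range_succ, Nat.cast_add, mul_add]
    exact add_le_add (ih (by omega)) (row_le k t m ht (by omega) Ps 0)

lemma sigma_ge (k : ℕ) :
    ∑ t ∈ Finset.range (k - 3), ∑ i0 ∈ Finset.range 636, ∑ len ∈ Finset.Ioc 0 1272,
        Ex (wrd k) (636 * (t + 1) + i0) len ≤ sigma (wrd k) := by
  rw [← Finset.sum_product', ← Finset.sum_product']
  unfold Ex
  rw [← Finset.sum_filter]
  set S := ((Finset.range (k - 3) ×ˢ Finset.range 636) ×ˢ Finset.Ioc 0 1272).filter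
    (fun x => IsRun (wrd k) (636 * (x.1.1 + 1) + x.1.2)
      (636 * (x.1.1 + 1) + x.1.2 + x.2 - 1)) with hS
  let f : (ℕ × ℕ) × ℕ → ℕ × ℕ := fun x =>
    (636 * (x.1.1 + 1) + x.1.2, 636 * (x.1.1 + 1) + x.1.2 + x.2 - 1)
  have hinj : Set.InjOn f S := by
    rintro ⟨⟨a, b⟩, c⟩ h ⟨⟨a', b'⟩, c'⟩ h' e
    simp only [hS, Finset.coe_filter, Finset.mem_product, Finset.mem_range, Finset.mem_Ioc,
      Set.mem_ofPred_eq] at h h'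
    simp only [f, Prod.mk.injEq] at e ⊢
    omega
  have : ∑ x ∈ S, exponent (wrd k) (636 * (x.1.1 + 1) + x.1.2)
      (636 * (x.1.1 + 1) + x.1.2 + x.2 - 1) =
      ∑ q ∈ S.image f, exponent (wrd k) q.1 q.2 := by
    rw [Finset.sum_image hinj]
  rw [this]
  unfold sigma
  apply Finset.sum_le_sum_of_subset_of_nonneg
  · intro q hq
    rw [Finset.mem_image] at hq
    obtain ⟨x, hx, rfl⟩ := hq
    have hr := (Finset.mem_filter.1 hx).2
    simp only [runs, Finset.mem_filter, Finset.mem_product, Finset.mem_range]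
    exact ⟨⟨lt_of_le_of_lt hr.1 hr.2.1, hr.2.1⟩, hr⟩
  · intro q hq _
    exact exponent_nonneg _ _ _ (Finset.mem_filter.1 hq).2.1

/-- There are infinitely many binary strings `w` with `σ(w) > 2.035 |w|`. -/
theorem sigma_lower_bound_two_point_035 :
    ∀ N : ℕ, ∃ w : List Bool, N < w.length ∧
      sigma w > (2.035 : ℚ) * (w.length : ℚ) := by
  intro N
  refine ⟨wrd (N + 10000), by rw [wrd_length]; omega, ?_⟩
  have h1 := sigma_ge (N + 10000)
  have hT : (1295600000 : ℚ) ≤ ((total (rep 4) 636 : ℕ) : ℚ) := by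
    have := Nat.le_of_ble_eq_true total_ge
    exact_mod_cast this
  have h2 : ∑ t ∈ Finset.range (N + 10000 - 3), (6478 / 5 : ℚ) ≤
      ∑ t ∈ Finset.range (N + 10000 - 3), ∑ i0 ∈ Finset.range 636,
        ∑ len ∈ Finset.Ioc 0 1272, Ex (wrd (N + 10000)) (636 * (t + 1) + i0) len := by
    apply Finset.sum_le_sum
    intro t ht
    rw [Finset.mem_range] at ht
    have := hT.trans (total_le (N + 10000) t (by omega) 636 le_rfl)
    linarith
  have h3 := h2.trans h1
  rw [Finset.sum_const, Finset.card_range, nsmul_eq_mul,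
    Nat.add_sub_assoc (by norm_num : 3 ≤ 10000) N] at h3
  rw [wrd_length]
  generalize sigma (wrd (N + 10000)) = s at h3 ⊢
  norm_num only [Nat.cast_add, Nat.cast_mul, Nat.cast_ofNat] at h3 ⊢
  have hN : (0 : ℚ) ≤ N := Nat.cast_nonneg N
  linarith
end RunsExp
end

section
/- Let φ be the morphism on the alphabet {a,b,c} given by φ(a)=baaba, φ(b)=ca, φ(c)=bca, and let ψ be the morphism from {a,b,c} to {0,1} given by ψ(a)=01011, ψ(b)=ψ(c)=01001011. Let w₈ = ψ(φ⁸(a)). Then |w₈| = 362327 and for every integer k ≥ 1, the word w = (w₈)^k (the k-fold concatenation of w₈ with itself) satisfies σ(w) > 2.035·|w|. -/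
open scoped Classical

namespace RunsExp

variable {α : Type*}

/-- The three-letter alphabet `{a, b, c}`. -/
inductive ABC : Type | a | b | c

open ABC in
/-- The morphism `φ` on `{a,b,c}`: `φ(a)=baaba`, `φ(b)=ca`, `φ(c)=bca` (values on letters). -/
def phi : ABC → List ABC
  | a => [b, a, a, b, a]
  | b => [c, a]
  | c => [b, c, a]

open ABC in
/-- The morphism `ψ : {a,b,c} → {0,1}`: `ψ(a)=01011`, `ψ(b)=ψ(c)=01001011`
(values on letters; `0 = false`, `1 = true`). -/
def psi : ABC → List Bool
  | a => [false, true, false, true, true]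
  | b => [false, true, false, false, true, false, true, true]
  | c => [false, true, false, false, true, false, true, true]

/-- The morphism `φ` extended to words by concatenation. -/
def phiW (l : List ABC) : List ABC := l.flatMap phi

/-- The morphism `ψ` extended to words by concatenation. -/
def psiW (l : List ABC) : List Bool := l.flatMap psi

/-- The binary word `w₈ = ψ(φ⁸(a))`. -/
def w8 : List Bool := psiW (phiW^[8] [ABC.a])


/-! ### Computational definitions, evaluated by the kernel -/

/-- Erosion: bit `i` of `er fuel Z l` says that bits `i, …, i+l-1` of `Z` are set. -/
def er : ℕ → ℕ → ℕ → ℕ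
  | 0, Z, _ => Z
  | k + 1, Z, l =>
    bif Nat.ble l 1 then Z
    else (er k Z ((l + 1) / 2)) &&& ((er k Z ((l + 1) / 2)) >>> (l - (l + 1) / 2))

/-- One step of the parallel bit count. -/
def popStep (w K X : ℕ) : ℕ :=
  (X &&& ((2 ^ (2 * w * K) - 1) / (2 ^ w + 1))) +
    ((X >>> w) &&& ((2 ^ (2 * w * K) - 1) / (2 ^ w + 1)))

/-- Sum of `2 ^ s` digits of `X` in base `2 ^ w`. -/
def popAux : ℕ → ℕ → ℕ → ℕ
  | 0, w, X => X % 2 ^ w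
  | s + 1, w, X => popAux s (2 * w) (popStep w (2 ^ s) X)

/-- The number of ones among the first `2 ^ 19` bits. -/
def pop (X : ℕ) : ℕ := popAux 19 1 X

/-- Iterating the morphism on encoded words. -/
def go : ℕ → ℕ → ℕ → ℕ → ℕ → ℕ → ℕ → ℕ × ℕ
  | 0, la, A, _, _, _, _ => (la, A)
  | m + 1, la, A, lb, B, lc, C =>
    go m (lb + (la + (la + (lb + la))))
      (B ||| ((A ||| ((A ||| ((B ||| (A <<< lb)) <<< la)) <<< la)) <<< lb))
      (lc + la) (C ||| (A <<< lc))
      (lb + (lc + la)) (B ||| ((C ||| (A <<< lc)) <<< lb))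

/-- The word `w8` as a length and a natural number. -/
def enc8 : ℕ × ℕ := go 8 5 26 8 210 8 210

/-- The bits of `w8`. -/
def W8 : ℕ := enc8.2

/-- Matches at distance `p` at positions strictly between `f` and `g`. -/
def zer (W p f g : ℕ) : ℕ :=
  (((2 ^ g - 1) ^^^ ((W ^^^ (W >>> p)) % 2 ^ g)) >>> (f + 1)) <<< (f + 1)

/-- Matches at distance `d` at all positions below `g`. -/
def zer0 (W d g : ℕ) : ℕ := (2 ^ g - 1) ^^^ ((W ^^^ (W >>> d)) % 2 ^ g)

/-- Start positions of the squares of period `p`. -/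
def sqs (W p f g : ℕ) : ℕ := er 19 (zer W p f g) p

/-- Last start position of each group of squares. -/
def ends (Y : ℕ) : ℕ := Y ^^^ (Y &&& (Y >>> 1))

/-- Total length of the inner runs of period `p`. -/
def tot (W p f g : ℕ) : ℕ :=
  pop (sqs W p f g) + (2 * p - 1) * pop (ends (sqs W p f g))

/-- No square of period `p` in the word has period `d`. -/
def okDiv (W n p d : ℕ) : Bool :=
  Nat.beq d p || Nat.beq (er 19 (zer0 W d (n - d)) (2 * p - d)) 0

/-- No square of period `p` in the word is a proper power. -/
def okPrim (W n p : ℕ) : Bool :=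
  (List.range 300).all fun d =>
    !(Nat.beq (p % (d + 1)) 0) || (okDiv W n p (d + 1) && okDiv W n p (p / (d + 1)))

/-- All side conditions for the entry `(p, f, g)`. -/
def okEntry (W n p f g : ℕ) : Bool :=
  Nat.ble 1 p && Nat.ble (p + 1) 90000 && Nat.ble (g + p + 1) n && Nat.ble (f + 1) g &&
  Nat.ble (2 * p) n &&
  (W.testBit f ^^ W.testBit (f + p)) && (W.testBit g ^^ W.testBit (g + p)) && okPrim W n p

/-- Periods, with the first and the last mismatch position. -/
def table : List (ℕ × ℕ × ℕ) :=
  [(1, 0, 362324), (2, 1, 362324), (3, 3, 362322), (5, 2, 362316), (8, 3, 362317),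
   (13, 11, 362303), (18, 2, 362285), (21, 24, 362304), (31, 2, 362272), (34, 16, 362291),
   (44, 2, 362228), (52, 24, 362273), (65, 24, 362260), (75, 2, 362158), (96, 24, 362229),
   (109, 16, 362216), (119, 2, 362158), (171, 89, 361987), (184, 11, 362132),
   (236, 260, 362089), (290, 1, 361697), (355, 2, 361970), (461, 1, 361671), (645, 2, 361026),
   (697, 195, 361628), (881, 260, 361444), (1106, 1, 359920), (1342, 260, 360983),
   (1751, 2, 359881), (2448, 1141, 357433), (2632, 11, 359684), (3329, 3589, 358996),
   (4199, 1, 353234), (5080, 2, 357245), (6647, 1, 353037), (9279, 2, 343758),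
   (9976, 2643, 352349), (12608, 3589, 349717), (15926, 1, 327832), (19255, 3589, 343070),
   (25205, 2, 327148), (35181, 37824, 291967), (37813, 11, 324503), (60386, 2, 231581),
   (72994, 3589, 289331)]

/-- Every entry of the table satisfies the side conditions. -/
theorem table_ok : (table.all fun e => okEntry W8 362327 e.1 e.2.1 e.2.2) = true := by
  decide +kernel

theorem table_sum :
    2035000 * 362327 + 1 ≤
      (table.map fun e => (1000000 * tot W8 e.1 e.2.1 e.2.2) / e.1).sum := by
  decide +kernel

theorem table_nodup : (table.map fun e => e.1).Nodup := by
  decide +kernel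

theorem enc8_len : enc8.1 = 362327 := by
  decide +kernel

/-! ### Correctness of the computational definitions -/

theorem er_spec (k : ℕ) : ∀ (Z l : ℕ), 1 ≤ l → l ≤ 2 ^ k → ∀ i,
    ((er k Z l).testBit i = true ↔ ∀ t < l, Z.testBit (i + t) = true) := by
  induction k with
  | zero =>
    intro Z l h1 h2 i
    have : l = 1 := by simp at h2; omega
    subst this
    simp [er]
  | succ k ih =>
    intro Z l h1 h2 i
    by_cases hl : l ≤ 1
    · have : l = 1 := by omega
      subst this
      have h11 : Nat.ble 1 1 = true := rfl
      simp [er, h11]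
    · have hb : Nat.ble l 1 = false := by
        rw [Bool.eq_false_iff]
        intro h
        exact hl (Nat.le_of_ble_eq_true h)
      have hm1 : 1 ≤ (l + 1) / 2 := by omega
      have hm2 : (l + 1) / 2 ≤ 2 ^ k := by rw [pow_succ] at h2; omega
      simp only [er, hb, cond_false, Nat.testBit_and, Nat.testBit_shiftRight, Bool.and_eq_true]
      rw [ih Z _ hm1 hm2, ih Z _ hm1 hm2]
      constructor
      · rintro ⟨ha, hc⟩ t ht
        by_cases h : t < (l + 1) / 2
        · exact ha t h
        · have := hc (t - (l - (l + 1) / 2)) (by omega)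
          have e : l - (l + 1) / 2 + i + (t - (l - (l + 1) / 2)) = i + t := by omega
          rwa [e] at this
      · intro h
        refine ⟨fun t ht => h t (by omega), fun t ht => ?_⟩
        have := h (l - (l + 1) / 2 + t) (by omega)
        have e : l - (l + 1) / 2 + i + t = i + (l - (l + 1) / 2 + t) := by omega
        rwa [e]

/-- Sum of the first `K` digits of `X` in base `2 ^ w`. -/
def dsum (w : ℕ) : ℕ → ℕ → ℕ
  | 0, _ => 0
  | K + 1, X => X % 2 ^ w + dsum w K (X / 2 ^ w)

/-- The mask of the even digits. -/
def mk (w : ℕ) : ℕ → ℕ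
  | 0 => 0
  | K + 1 => 2 ^ (2 * w) * mk w K + (2 ^ w - 1)

theorem mk_mul (w K : ℕ) : mk w K * (2 ^ w + 1) = 2 ^ (2 * w * K) - 1 := by
  induction K with
  | zero => simp [mk]
  | succ K ih =>
    have h1 : 1 ≤ 2 ^ w := Nat.one_le_two_pow
    have h2 : 1 ≤ 2 ^ (2 * w * K) := Nat.one_le_two_pow
    have h3 : 1 ≤ 2 ^ (2 * w * (K + 1)) := Nat.one_le_two_pow
    zify [h1, h2, h3, mk] at ih ⊢
    have e : (2 : ℤ) ^ (2 * w * (K + 1)) = (2 ^ w) ^ 2 * 2 ^ (2 * w * K) := by ring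
    have e2 : (2 : ℤ) ^ (2 * w) = (2 ^ w) ^ 2 := by ring
    rw [e, e2]
    linear_combination ((2 : ℤ) ^ w) ^ 2 * ih

theorem mk_eq (w K : ℕ) : (2 ^ (2 * w * K) - 1) / (2 ^ w + 1) = mk w K := by
  rw [← mk_mul, Nat.mul_div_cancel _ (Nat.succ_pos _)]

theorem land_mk (w K Y : ℕ) :
    Y &&& mk w (K + 1) = 2 ^ (2 * w) * ((Y / 2 ^ (2 * w)) &&& mk w K) + Y % 2 ^ w := by
  have hlt : 2 ^ w - 1 < 2 ^ (2 * w) := by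
    have : 2 ^ w ≤ 2 ^ (2 * w) := Nat.pow_le_pow_right (by norm_num) (by omega)
    have : 1 ≤ 2 ^ w := Nat.one_le_two_pow
    omega
  have hlt2 : Y % 2 ^ w < 2 ^ (2 * w) := by
    have : Y % 2 ^ w < 2 ^ w := Nat.mod_lt _ (Nat.pos_of_ne_zero (by positivity))
    omega
  apply Nat.eq_of_testBit_eq
  intro i
  rw [mk, Nat.testBit_and, Nat.testBit_two_pow_mul_add _ hlt, Nat.testBit_two_pow_mul_add _ hlt2]
  split
  · rw [Nat.testBit_two_pow_sub_one, Nat.testBit_mod_two_pow, Bool.and_comm]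
  · rename_i h
    rw [Nat.testBit_and, Nat.testBit_div_two_pow]
    congr 2
    omega

theorem popStep_succ (w K X : ℕ) :
    popStep w (K + 1) X = 2 ^ (2 * w) * popStep w K (X / 2 ^ (2 * w)) +
      (X % 2 ^ w + X / 2 ^ w % 2 ^ w) := by
  simp only [popStep, mk_eq, land_mk, Nat.shiftRight_eq_div_pow]
  rw [Nat.div_div_eq_div_mul, Nat.div_div_eq_div_mul, mul_comm (2 ^ w)]
  ring

theorem dsum_popStep (w : ℕ) (hw : 1 ≤ w) (K : ℕ) : ∀ X,
    dsum w (2 * K) X = dsum (2 * w) K (popStep w K X) := by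
  induction K with
  | zero => intro X; simp [dsum]
  | succ K ih =>
    intro X
    have hb : 2 ≤ 2 ^ w := by
      calc 2 = 2 ^ 1 := by norm_num
        _ ≤ 2 ^ w := Nat.pow_le_pow_right (by norm_num) hw
    have h1 : X % 2 ^ w < 2 ^ w := Nat.mod_lt _ (by omega)
    have h2 : X / 2 ^ w % 2 ^ w < 2 ^ w := Nat.mod_lt _ (by omega)
    have h3 : 2 * 2 ^ w ≤ 2 ^ (2 * w) := by
      rw [two_mul w, pow_add]; exact Nat.mul_le_mul_right _ hb
    have h4 : X % 2 ^ w + X / 2 ^ w % 2 ^ w < 2 ^ (2 * w) := by omega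
    have e : 2 * (K + 1) = 2 * K + 1 + 1 := by ring
    rw [e, dsum, dsum, dsum, popStep_succ, Nat.mul_add_mod, Nat.mod_eq_of_lt h4,
      Nat.mul_add_div (by positivity), Nat.div_eq_of_lt h4, add_zero, ih,
      Nat.div_div_eq_div_mul, ← pow_add, ← two_mul, add_assoc]

theorem popAux_eq (s : ℕ) : ∀ w X, 1 ≤ w → popAux s w X = dsum w (2 ^ s) X := by
  induction s with
  | zero => intro w X _; simp [popAux, dsum]
  | succ s ih =>
    intro w X hw
    rw [popAux, ih _ _ (by omega), pow_succ, mul_comm (2 ^ s) 2, dsum_popStep w hw]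

theorem dsum_one (K : ℕ) : ∀ X,
    dsum 1 K X = ((Finset.range K).filter fun i => X.testBit i = true).card := by
  induction K with
  | zero => intro X; simp [dsum]
  | succ K ih =>
    intro X
    rw [dsum, ih, Finset.card_filter, Finset.card_filter, Finset.sum_range_succ']
    rw [add_comm]
    congr 1
    · apply Finset.sum_congr rfl
      intro i _
      rw [pow_one, Nat.testBit_div_two]
    · rw [Nat.testBit_zero]
      rcases Nat.mod_two_eq_zero_or_one X with h | h <;> simp [h]

theorem pop_eq (X : ℕ) :
    pop X = ((Finset.range (2 ^ 19)).filter fun i => X.testBit i = true).card := by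
  rw [pop, popAux_eq _ _ _ le_rfl, dsum_one]

/-- `n` encodes the word `L` of length `l`. -/
def Enc (l n : ℕ) (L : List Bool) : Prop :=
  L.length = l ∧ ∀ i, n.testBit i = (L[i]?).getD false

theorem Enc.cat {l₁ n₁ l₂ n₂ : ℕ} {L₁ L₂ : List Bool} (h₁ : Enc l₁ n₁ L₁) (h₂ : Enc l₂ n₂ L₂) :
    Enc (l₁ + l₂) (n₁ ||| (n₂ <<< l₁)) (L₁ ++ L₂) := by
  obtain ⟨a₁, b₁⟩ := h₁
  obtain ⟨a₂, b₂⟩ := h₂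
  refine ⟨by simp [a₁, a₂], fun i => ?_⟩
  rw [Nat.testBit_or, Nat.testBit_shiftLeft, b₁, b₂, List.getElem?_append, a₁]
  by_cases h : i < l₁
  · simp [h]
  · have : L₁[i]? = none := by simp; omega
    simp [h, this]
    omega

/-- `ψ ∘ φ ^ m`. -/
def H (m : ℕ) (l : List ABC) : List Bool := psiW (phiW^[m] l)

theorem phiW_iter_append (m : ℕ) : ∀ l₁ l₂ : List ABC,
    phiW^[m] (l₁ ++ l₂) = phiW^[m] l₁ ++ phiW^[m] l₂ := by
  induction m with
  | zero => intro l₁ l₂; rfl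
  | succ m ih =>
    intro l₁ l₂
    rw [Function.iterate_succ_apply, Function.iterate_succ_apply, Function.iterate_succ_apply, ← ih]
    simp [phiW]

theorem H_append (m : ℕ) (l₁ l₂ : List ABC) : H m (l₁ ++ l₂) = H m l₁ ++ H m l₂ := by
  rw [H, phiW_iter_append]; simp [H, psiW]

theorem H_cons (m : ℕ) (x y : ABC) (l : List ABC) :
    H m (x :: y :: l) = H m [x] ++ H m (y :: l) := by
  rw [← H_append]; rfl

theorem H_succ (m : ℕ) (x : ABC) : H (m + 1) [x] = H m (phi x) := by
  rw [H, Function.iterate_succ_apply]; simp [H, phiW]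

theorem go_spec (m : ℕ) : ∀ (s la A lb B lc C : ℕ), Enc la A (H s [ABC.a]) →
    Enc lb B (H s [ABC.b]) → Enc lc C (H s [ABC.c]) →
    Enc (go m la A lb B lc C).1 (go m la A lb B lc C).2 (H (s + m) [ABC.a]) := by
  induction m with
  | zero => intro s la A lb B lc C h _ _; exact h
  | succ m ih =>
    intro s la A lb B lc C ha hb hc
    have e : s + (m + 1) = (s + 1) + m := by ring
    rw [e, go]
    apply ih
    · rw [H_succ]
      simp only [phi, H_cons]
      exact hb.cat (ha.cat (ha.cat (hb.cat ha)))
    · rw [H_succ]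
      simp only [phi, H_cons]
      exact hc.cat ha
    · rw [H_succ]
      simp only [phi, H_cons]
      exact hb.cat (hc.cat ha)

theorem enc_of_small (l n : ℕ) (L : List Bool) (h1 : L.length = l) (h2 : n < 2 ^ l)
    (h3 : ∀ i < l, n.testBit i = (L[i]?).getD false) : Enc l n L := by
  refine ⟨h1, fun i => ?_⟩
  by_cases h : i < l
  · exact h3 i h
  · have : L[i]? = none := by simp; omega
    rw [this, Nat.testBit_lt_two_pow (lt_of_lt_of_le h2 (Nat.pow_le_pow_right (by norm_num) (by omega)))]
    rfl

theorem enc8_spec : Enc enc8.1 enc8.2 w8 := by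
  have := go_spec 8 0 5 26 8 210 8 210
    (enc_of_small _ _ _ (by decide) (by decide) (by decide))
    (enc_of_small _ _ _ (by decide) (by decide) (by decide))
    (enc_of_small _ _ _ (by decide) (by decide) (by decide))
  exact this

theorem w8_length : w8.length = 362327 := enc8_spec.1.trans enc8_len

theorem w8_get (i : ℕ) (hi : i < 362327) : w8[i]? = some (W8.testBit i) := by
  have h := enc8_spec.2 i
  have hl : i < w8.length := by rw [w8_length]; exact hi
  rw [W8, h, List.getElem?_eq_getElem hl]
  rfl

/-! ### Periods and runs -/

theorem pow_get {β : Type*} (L : List β) (k : ℕ) : ∀ t i, t < k → i < L.length →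
    ((List.replicate k L).flatten)[t * L.length + i]? = L[i]? := by
  induction k with
  | zero => intro t i h; omega
  | succ k ih =>
    intro t i ht hi
    rw [List.replicate_succ, List.flatten_cons]
    cases t with
    | zero => rw [zero_mul, zero_add, List.getElem?_append_left hi]
    | succ t =>
      have e : (t + 1) * L.length + i = L.length + (t * L.length + i) := by ring
      rw [e, List.getElem?_append_right (by omega), Nat.add_sub_cancel_left]
      exact ih t i (by omega) hi

theorem per_gcd {β : Type*} (v : ℕ → β) (a b : ℕ) (s : ℕ) : ∀ p q : ℕ, p + q ≤ s →
    0 < p → 0 < q → a + (p + q) ≤ b + 1 →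
    (∀ t, a ≤ t → t + p ≤ b → v t = v (t + p)) →
    (∀ t, a ≤ t → t + q ≤ b → v t = v (t + q)) →
    ∀ t, a ≤ t → t + Nat.gcd p q ≤ b → v t = v (t + Nat.gcd p q) := by
  induction s with
  | zero => intro p q h hp; omega
  | succ s ih =>
    have key : ∀ p q : ℕ, p < q → a + (p + q) ≤ b + 1 →
        (∀ t, a ≤ t → t + p ≤ b → v t = v (t + p)) →
        (∀ t, a ≤ t → t + q ≤ b → v t = v (t + q)) →
        (∀ t, a ≤ t → t + (q - p) ≤ b → v t = v (t + (q - p))) := by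
      intro p q hpq hl h1 h2 t ht htb
      by_cases h : t + q ≤ b
      · rw [h2 t ht h, h1 (t + (q - p)) (by omega) (by omega)]
        congr 1; omega
      · have e1 := h1 (t - p) (by omega) (by omega)
        have e2 := h2 (t - p) (by omega) (by omega)
        rw [Nat.sub_add_cancel (by omega)] at e1
        rw [← e1, e2]
        congr 1; omega
    intro p q hs hp hq hl h1 h2
    rcases lt_trichotomy p q with h | h | h
    · have := ih p (q - p) (by omega) hp (by omega) (by omega) h1 (key p q h hl h1 h2)
      rwa [Nat.gcd_sub_self_right (by omega)] at this
    · subst h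
      rwa [Nat.gcd_self]
    · have := ih (p - q) q (by omega) (by omega) hq (by omega)
        (key q p h (by omega) h2 h1) h2
      rwa [Nat.gcd_sub_self_left (by omega)] at this

theorem factor_length_s1 {β : Type*} (u : List β) (a b : ℕ) (hab : a ≤ b) (hb : b < u.length) :
    (factor u a b).length = b - a + 1 := by
  simp [factor]; omega

theorem factor_get_s1 {β : Type*} (u : List β) (a b t : ℕ) (ht : t < b - a + 1) :
    (factor u a b)[t]? = u[a + t]? := by
  simp [factor, ht]

theorem isPeriod_factor {β : Type*} (u : List β) (a b q : ℕ) (hab : a ≤ b) (hb : b < u.length) :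
    IsPeriod (factor u a b) q ↔ 0 < q ∧ ∀ t, a ≤ t → t + q ≤ b → u[t]? = u[t + q]? := by
  unfold IsPeriod
  rw [factor_length_s1 u a b hab hb]
  refine and_congr Iff.rfl ⟨fun h t ht htb => ?_, fun h i hi => ?_⟩
  · have := h (t - a) (by omega)
    rw [factor_get_s1 _ _ _ _ (by omega), factor_get_s1 _ _ _ _ (by omega)] at this
    have e1 : a + (t - a) = t := by omega
    have e2 : a + (t - a + q) = t + q := by omega
    rwa [e1, e2] at this
  · rw [factor_get_s1 _ _ _ _ (by omega), factor_get_s1 _ _ _ _ (by omega), ← add_assoc]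
    exact h (a + i) (by omega) (by omega)

theorem minPeriod_factor {β : Type*} (u : List β) (a b p : ℕ) (hp : 0 < p) (hb : b < u.length)
    (hl : a + 2 * p ≤ b + 1) (hper : ∀ t, a ≤ t → t + p ≤ b → u[t]? = u[t + p]?)
    (hprim : ∀ d, d ∣ p → d < p → ∃ t, a ≤ t ∧ t + d ≤ b ∧ u[t]? ≠ u[t + d]?) :
    minPeriod (factor u a b) = p := by
  have hab : a ≤ b := by omega
  have hmem : p ∈ {q | IsPeriod (factor u a b) q} :=
    (isPeriod_factor u a b p hab hb).2 ⟨hp, hper⟩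
  apply le_antisymm (Nat.sInf_le hmem)
  by_contra hlt
  have hlt : minPeriod (factor u a b) < p := not_le.1 hlt
  have hq : IsPeriod (factor u a b) (minPeriod (factor u a b)) := Nat.sInf_mem ⟨p, hmem⟩
  generalize minPeriod (factor u a b) = q at hlt hq
  obtain ⟨hq0, hq1⟩ := (isPeriod_factor u a b q hab hb).1 hq
  have hg := per_gcd (fun t => u[t]?) a b (q + p) q p le_rfl hq0 hp (by omega) hq1 hper
  obtain ⟨t, h1, h2, h3⟩ := hprim (Nat.gcd q p) (Nat.gcd_dvd_right _ _)
    (lt_of_le_of_lt (Nat.gcd_le_left p hq0) hlt)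
  exact h3 (hg t h1 h2)

/-- `(i, c)` describes an inner run of period `p` of the word of length `n` with bits `W`, namely `[i..c+p-1]`. -/
def Good (W n p i c : ℕ) : Prop :=
  1 ≤ i ∧ i + p ≤ c ∧ c + p < n ∧
  (∀ t, i ≤ t → t < c → W.testBit t = W.testBit (t + p)) ∧
  W.testBit (i - 1) ≠ W.testBit (i - 1 + p) ∧
  W.testBit c ≠ W.testBit (c + p) ∧
  ∀ d, d ∣ p → d < p → ∃ t, i ≤ t ∧ t + d < c + p ∧ W.testBit t ≠ W.testBit (t + d)

/-- The inner runs of period `p`. -/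
noncomputable def innerRuns (W n p : ℕ) : Finset (ℕ × ℕ) :=
  (Finset.range n ×ˢ Finset.range n).filter fun r => Good W n p r.1 r.2

theorem good_run (W n : ℕ) (L : List Bool) (hn : L.length = n)
    (hW : ∀ i < n, L[i]? = some (W.testBit i)) (k t p i c : ℕ) (hp : 0 < p) (ht : t < k) (h : Good W n p i c) :
    minPeriod (factor (List.replicate k L).flatten (t * n + i) (t * n + c + p - 1)) = p ∧
    (t * n + i, t * n + c + p - 1) ∈ runs (List.replicate k L).flatten := by
  obtain ⟨h1, h2, h3, h4, h5, h6, h7⟩ := h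
  set u := (List.replicate k L).flatten with hu
  have hlen : u.length = k * n := by simp [hu, hn]
  have hget : ∀ x, x < n → u[t * n + x]? = some (W.testBit x) := by
    intro x hx
    have := pow_get L k t x ht (by rw [hn]; exact hx)
    rw [hn, hW x hx] at this
    exact this
  have hkt : t * n + n ≤ k * n := by
    rw [← Nat.succ_mul]; exact Nat.mul_le_mul_right _ ht
  have hmin : minPeriod (factor u (t * n + i) (t * n + c + p - 1)) = p := by
    apply minPeriod_factor u _ _ p hp (by omega) (by omega)
    · intro x hx hxb
      obtain ⟨y, rfl⟩ : ∃ y, x = t * n + y := ⟨x - t * n, by omega⟩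
      rw [add_assoc, hget y (by omega), hget (y + p) (by omega), h4 y (by omega) (by omega)]
    · intro d hd hdp
      obtain ⟨y, hy1, hy2, hy3⟩ := h7 d hd hdp
      refine ⟨t * n + y, by omega, by omega, ?_⟩
      rw [add_assoc, hget y (by omega), hget (y + d) (by omega)]
      simpa using hy3
  refine ⟨hmin, ?_⟩
  unfold runs
  rw [Finset.mem_filter, Finset.mem_product, Finset.mem_range, Finset.mem_range]
  refine ⟨⟨?_, ?_⟩, ?_, ?_, ?_, ?_, ?_⟩
  · show t * n + i < _
    omega
  · show t * n + c + p - 1 < _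
    omega
  · show t * n + i ≤ t * n + c + p - 1
    omega
  · show t * n + c + p - 1 < _
    omega
  · simp only [hmin]
    omega
  · right
    simp only [hmin]
    have e1 : t * n + i - 1 = t * n + (i - 1) := by omega
    have e2 : t * n + i + p - 1 = t * n + (i - 1 + p) := by omega
    rw [e1, e2, hget _ (by omega), hget _ (by omega)]
    simpa using h5
  · right
    simp only [hmin]
    have e1 : t * n + c + p - 1 - p + 1 = t * n + c := by omega
    have e2 : t * n + c + p - 1 + 1 = t * n + (c + p) := by omega
    rw [e1, e2, hget _ (by omega), hget _ (by omega)]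
    simpa using h6

/-! ### Counting inner runs -/

theorem zer0_testBit (W d g t : ℕ) : (zer0 W d g).testBit t = true ↔
    t < g ∧ W.testBit t = W.testBit (t + d) := by
  rw [zer0, Nat.testBit_xor, Nat.testBit_two_pow_sub_one, Nat.testBit_mod_two_pow,
    Nat.testBit_xor, Nat.testBit_shiftRight, add_comm d t]
  by_cases h : t < g <;> simp [h]

theorem zer_testBit (W p f g t : ℕ) : (zer W p f g).testBit t = true ↔
    f < t ∧ t < g ∧ W.testBit t = W.testBit (t + p) := by
  have e : zer W p f g = ((zer0 W p g) >>> (f + 1)) <<< (f + 1) := rfl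
  rw [e, Nat.testBit_shiftLeft, Nat.testBit_shiftRight, Bool.and_eq_true, ← zer0_testBit]
  by_cases h : f < t
  · have e : f + 1 + (t - (f + 1)) = t := by omega
    simp [h, e]
  · simp [h]

theorem okDiv_spec (n p d : ℕ) (W : ℕ) (hp : p < 90000) (hd : d < p) (h : okDiv W n p d = true) :
    ∀ i, i + 2 * p ≤ n → ∃ t, i ≤ t ∧ t + d < i + 2 * p ∧ W.testBit t ≠ W.testBit (t + d) := by
  intro i hi
  rw [okDiv, Bool.or_eq_true, Nat.beq_eq, Nat.beq_eq] at h
  have h0 : er 19 (zer0 W d (n - d)) (2 * p - d) = 0 := h.resolve_left (by omega)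
  by_contra hc
  push Not at hc
  have hs := (er_spec 19 (zer0 W d (n - d)) (2 * p - d) (by omega) (by norm_num; omega) i).2 (by
    intro t ht
    rw [zer0_testBit]
    exact ⟨by omega, hc (i + t) (by omega) (by omega)⟩)
  rw [h0] at hs
  simp at hs

theorem okPrim_spec (n p d : ℕ) (W : ℕ) (hp0 : 0 < p) (hp : p < 90000) (hdp : d ∣ p) (hd : d < p)
    (h : okPrim W n p = true) : okDiv W n p d = true := by
  rw [okPrim, List.all_eq_true] at h
  obtain ⟨m, rfl⟩ := hdp
  have hd0 : 0 < d := Nat.pos_of_mul_pos_right hp0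
  have hm0 : 0 < m := Nat.pos_of_mul_pos_left hp0
  have key : ∀ x y, 0 < x → x ≤ 300 → x * y = d * m →
      okDiv W n (d * m) x = true ∧ okDiv W n (d * m) y = true := by
    intro x y hx hx3 hxy
    have := h (x - 1) (by rw [List.mem_range]; omega)
    rw [Nat.sub_add_cancel hx, ← hxy, Nat.mul_mod_right, Nat.mul_div_cancel_left _ hx] at this
    have hb : Nat.beq 0 0 = true := rfl
    rw [hb] at this
    rw [← hxy]
    simpa using this
  by_cases hd3 : d ≤ 300
  · exact (key d m hd0 hd3 rfl).1
  · refine (key m d hm0 ?_ (mul_comm _ _)).2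
    by_contra hm
    have : 301 * 301 ≤ d * m := Nat.mul_le_mul (by omega) (by omega)
    omega

theorem tot_le (W n p f g : ℕ) (h : okEntry W n p f g = true) :
    0 < p ∧ tot W p f g ≤ ∑ r ∈ innerRuns W n p, (r.2 - r.1 + p) := by
  simp only [okEntry, Bool.and_eq_true, Nat.ble_eq, bne_iff_ne] at h
  obtain ⟨⟨⟨⟨⟨⟨⟨hp, hp9⟩, hg⟩, hfg⟩, hpn⟩, hf1⟩, hg1⟩, hprim⟩ := h
  refine ⟨hp, ?_⟩
  have hf : W.testBit f ≠ W.testBit (f + p) := by simpa using hf1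
  have hgm : W.testBit g ≠ W.testBit (g + p) := by simpa using hg1
  clear hf1 hg1
  let x : ℕ → Prop := fun t => W.testBit t ≠ W.testBit (t + p)
  -- membership of squares
  have hY : ∀ y, (sqs W p f g).testBit y = true ↔
      ∀ t < p, f < y + t ∧ y + t < g ∧ ¬ x (y + t) := by
    intro y
    rw [sqs, er_spec 19 _ p hp (by norm_num; omega)]
    refine forall_congr' fun t => forall_congr' fun _ => ?_
    rw [zer_testBit]
    simp [x]
  let lo : ℕ → ℕ := fun y => Nat.findGreatest x y + 1
  have hex : ∀ y, y ≤ g → ∃ c, y ≤ c ∧ x c := fun y hy => ⟨g, hy, hgm⟩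
  let hi : ℕ → ℕ := fun y => if h : ∃ c, y ≤ c ∧ x c then Nat.find h else 0
  have hprop : ∀ y, (sqs W p f g).testBit y = true →
      (1 ≤ lo y ∧ lo y ≤ y ∧ x (lo y - 1) ∧ y + p ≤ hi y ∧ hi y ≤ g ∧ x (hi y) ∧
        (∀ t, lo y ≤ t → t < hi y → ¬ x t)) := by
    intro y hy
    rw [hY] at hy
    have hy0 := hy 0 hp
    rw [add_zero] at hy0
    obtain ⟨hfy, hyg, hxy⟩ := hy0
    have hhi : hi y = Nat.find (hex y hyg.le) := dif_pos (hex y hyg.le)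
    have hs := Nat.find_spec (hex y hyg.le)
    have hm := Nat.find_min' (hex y hyg.le) ⟨hyg.le, hgm⟩
    have hmin : ∀ t, y ≤ t → t < hi y → ¬ x t := by
      intro t h1 h2 h3
      rw [hhi] at h2
      exact Nat.find_min (hex y hyg.le) h2 ⟨h1, h3⟩
    rw [← hhi] at hs hm
    have hle : Nat.findGreatest x y ≤ y := Nat.findGreatest_le y
    have hsp : x (Nat.findGreatest x y) := Nat.findGreatest_spec (P := x) hfy.le hf
    have hne : Nat.findGreatest x y ≠ y := fun e => hxy (e ▸ hsp)
    refine ⟨Nat.succ_pos _, ?_, ?_, ?_, hm, hs.2, ?_⟩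
    · show Nat.findGreatest x y + 1 ≤ y
      omega
    · exact hsp
    · by_contra hlt
      obtain ⟨h1, h2⟩ := hs
      have := (hy (hi y - y) (by omega)).2.2
      rw [Nat.add_sub_cancel' h1] at this
      exact this h2
    · intro t h1 h2
      by_cases hty : y ≤ t
      · exact hmin t hty h2
      · have h1 : Nat.findGreatest x y < t := h1
        exact Nat.findGreatest_is_greatest h1 (by omega)
  have hgood : ∀ y, (sqs W p f g).testBit y = true → (lo y, hi y) ∈ innerRuns W n p := by
    intro y hy
    obtain ⟨h1, h2, h3, h4, h5, h6, h7⟩ := hprop y hy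
    rw [innerRuns, Finset.mem_filter, Finset.mem_product, Finset.mem_range, Finset.mem_range]
    refine ⟨⟨?_, ?_⟩, h1, ?_, ?_, ?_, h3, h6, ?_⟩
    · show lo y < _
      omega
    · show hi y < _
      omega
    · show lo y + p ≤ hi y
      omega
    · show hi y + p < _
      omega
    · intro t ht1 ht2
      exact not_not.1 (h7 t ht1 ht2)
    · intro d hd hdp
      obtain ⟨t, ht1, ht2, ht3⟩ := okDiv_spec n p d W (by omega) hdp
        (okPrim_spec _ _ _ _ hp (by omega) hd hdp hprim) (lo y) (by omega)
      exact ⟨t, ht1, by show t + d < hi y + p; omega, ht3⟩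
  have hE : ∀ y, (ends (sqs W p f g)).testBit y = true →
      (sqs W p f g).testBit y = true ∧ hi y = y + p := by
    intro y hy
    rw [ends, Nat.testBit_xor, Nat.testBit_and, Nat.testBit_shiftRight, add_comm 1 y] at hy
    have hy1 : (sqs W p f g).testBit y = true ∧ ¬ (sqs W p f g).testBit (y + 1) = true := by
      revert hy
      cases (sqs W p f g).testBit y <;> cases (sqs W p f g).testBit (y + 1) <;> simp
    refine ⟨hy1.1, ?_⟩
    obtain ⟨h1, h2, h3, h4, h5, h6, h7⟩ := hprop y hy1.1
    by_contra hne
    apply hy1.2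
    rw [hY]
    intro t ht
    have hy0 := (hY y).1 hy1.1 0 hp
    exact ⟨by omega, by omega, h7 _ (by omega) (by omega)⟩
  rw [tot, pop_eq, pop_eq]
  generalize 2 ^ 19 = N
  set S := (Finset.range N).filter fun i => (sqs W p f g).testBit i = true with hS
  set E := (Finset.range N).filter fun i => (ends (sqs W p f g)).testBit i = true with hEE
  have hS' : ∀ y ∈ S, (sqs W p f g).testBit y = true := fun y hy => (Finset.mem_filter.1 hy).2
  have hE' : ∀ y ∈ E, (ends (sqs W p f g)).testBit y = true :=
    fun y hy => (Finset.mem_filter.1 hy).2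
  rw [Finset.card_eq_sum_card_fiberwise (f := fun y => (lo y, hi y)) (s := S) (t := innerRuns W n p)
      (fun y hy => hgood y (hS' y hy)),
    Finset.card_eq_sum_card_fiberwise (f := fun y => (lo y, hi y)) (s := E) (t := innerRuns W n p)
      (fun y hy => hgood y (hE y (hE' y hy)).1), Finset.mul_sum, ← Finset.sum_add_distrib]
  apply Finset.sum_le_sum
  rintro ⟨i, c⟩ hr
  rw [innerRuns, Finset.mem_filter] at hr
  have hic : i + p ≤ c := hr.2.2.1
  have c1 : (S.filter fun y => (lo y, hi y) = (i, c)).card ≤ c - p + 1 - i := by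
    rw [← Nat.card_Icc]
    apply Finset.card_le_card
    intro y hy
    rw [Finset.mem_filter, Prod.mk.injEq] at hy
    obtain ⟨hy, e1, e2⟩ := hy
    obtain ⟨h1, h2, h3, h4, h5, h6, h7⟩ := hprop y (hS' y hy)
    rw [Finset.mem_Icc]
    omega
  have c2 : (E.filter fun y => (lo y, hi y) = (i, c)).card ≤ 1 := by
    rw [Finset.card_le_one]
    intro y hy z hz
    rw [Finset.mem_filter, Prod.mk.injEq] at hy hz
    have e1 := (hE y (hE' y hy.1)).2
    have e2 := (hE z (hE' z hz.1)).2
    omega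
  have c3 := Nat.mul_le_mul_left (2 * p - 1) c2
  show _ ≤ c - i + p
  omega

/-! ### The final estimate -/

theorem sigma_ge_s1 (W n : ℕ) (L : List Bool) (hn : L.length = n)
    (hW : ∀ i < n, L[i]? = some (W.testBit i)) (k : ℕ) (ps : Finset ℕ) (hps : ∀ p ∈ ps, 0 < p) :
    ∑ p ∈ ps, (k : ℚ) * ((∑ r ∈ innerRuns W n p, (r.2 - r.1 + p) : ℕ) : ℚ) / p ≤
      sigma (List.replicate k L).flatten := by
  set u := (List.replicate k L).flatten with hu
  let D : Finset (Σ _ : ℕ, (ℕ × ℕ) × ℕ) := ps.sigma fun p => innerRuns W n p ×ˢ Finset.range k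
  let F : (Σ _ : ℕ, (ℕ × ℕ) × ℕ) → ℕ × ℕ := fun z =>
    (z.2.2 * n + z.2.1.1, z.2.2 * n + z.2.1.2 + z.1 - 1)
  have hD : ∀ z ∈ D, 0 < z.1 ∧ z.2.2 < k ∧ Good W n z.1 z.2.1.1 z.2.1.2 := by
    intro z hz
    rw [Finset.mem_sigma, Finset.mem_product, innerRuns, Finset.mem_filter, Finset.mem_range] at hz
    exact ⟨hps _ hz.1, hz.2.2, hz.2.1.2⟩
  have hrun : ∀ z ∈ D, minPeriod (factor u (F z).1 (F z).2) = z.1 ∧ F z ∈ runs u := by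
    intro z hz
    obtain ⟨h1, h2, h3⟩ := hD z hz
    exact good_run W n L hn hW k z.2.2 z.1 z.2.1.1 z.2.1.2 h1 h2 h3
  have hinj : Set.InjOn F D := by
    intro z hz z' hz' he
    have m1 := (hrun z hz).1
    have m2 := (hrun z' hz').1
    rw [he, m2] at m1
    obtain ⟨h1, h2, h3⟩ := hD z hz
    obtain ⟨h1', h2', h3'⟩ := hD z' hz'
    obtain ⟨g1, g2, g3, -⟩ := h3
    obtain ⟨g1', g2', g3', -⟩ := h3'
    obtain ⟨p, ⟨i, c⟩, t⟩ := z
    obtain ⟨p', ⟨i', c'⟩, t'⟩ := z'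
    simp only [F, Prod.mk.injEq] at he m1 g1 g2 g3 g1' g2' g3' h1 h1'
    obtain ⟨e1, e2⟩ := he
    subst m1
    have et : t = t' := by
      have q1 : (t * n + i) / n = t := by
        rw [mul_comm, Nat.mul_add_div (by omega), Nat.div_eq_of_lt (by omega), add_zero]
      have q2 : (t' * n + i') / n = t' := by
        rw [mul_comm, Nat.mul_add_div (by omega), Nat.div_eq_of_lt (by omega), add_zero]
      rw [← q1, e1, q2]
    subst et
    have ei : i = i' := by omega
    have ec : c = c' := by omega
    rw [ei, ec]
  have hsub : D.image F ⊆ runs u := by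
    intro r hr
    obtain ⟨z, hz, rfl⟩ := Finset.mem_image.1 hr
    exact (hrun z hz).2
  have hle : ∑ q ∈ D.image F, exponent u q.1 q.2 ≤ sigma u := by
    apply Finset.sum_le_sum_of_subset_of_nonneg hsub
    intro q hq _
    rw [runs, Finset.mem_filter] at hq
    have : (q.1 : ℚ) ≤ q.2 := by exact_mod_cast hq.2.1
    apply div_nonneg _ (Nat.cast_nonneg _)
    linarith
  refine le_trans (le_of_eq ?_) hle
  rw [Finset.sum_image hinj, Finset.sum_sigma]
  apply Finset.sum_congr rfl
  intro p hp
  rw [Finset.sum_product]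
  push_cast
  rw [Finset.mul_sum, Finset.sum_div]
  apply Finset.sum_congr rfl
  intro r hr
  have hterm : ∀ t ∈ Finset.range k, exponent u (F ⟨p, r, t⟩).1 (F ⟨p, r, t⟩).2 =
      (((r.2 - r.1 : ℕ) : ℚ) + p) / p := by
    intro t ht
    have hz : (⟨p, r, t⟩ : Σ _ : ℕ, (ℕ × ℕ) × ℕ) ∈ D := by
      rw [Finset.mem_sigma, Finset.mem_product]
      exact ⟨hp, hr, ht⟩
    obtain ⟨h1, h2, h3⟩ := hD _ hz
    obtain ⟨g1, g2, g3, -⟩ := h3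
    simp only at h1 g1 g2 g3
    rw [exponent, (hrun _ hz).1]
    congr 1
    have e : (F ⟨p, r, t⟩).2 + 1 = (F ⟨p, r, t⟩).1 + ((r.2 - r.1) + p) := by
      simp only [F]
      omega
    have e' : (((F ⟨p, r, t⟩).2 : ℚ)) + 1 = (F ⟨p, r, t⟩).1 + (((r.2 - r.1 : ℕ) : ℚ) + p) := by
      exact_mod_cast e
    linarith
  rw [Finset.sum_congr rfl hterm, Finset.sum_const, Finset.card_range, nsmul_eq_mul, mul_div_assoc]

theorem list_bound : (2035000 * 362327 + 1 : ℚ) ≤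
    ∑ p ∈ (table.map fun e => e.1).toFinset,
      1000000 * ((∑ r ∈ innerRuns W8 362327 p, (r.2 - r.1 + p) : ℕ) : ℚ) / p := by
  rw [List.sum_toFinset _ table_nodup, List.map_map]
  have h := table_sum
  have h' : ((2035000 * 362327 + 1 : ℕ) : ℚ) ≤
      (((table.map fun e => (1000000 * tot W8 e.1 e.2.1 e.2.2) / e.1).sum : ℕ) : ℚ) :=
    by exact_mod_cast h
  rw [Nat.cast_list_sum, List.map_map] at h'
  have h0 : (2035000 * 362327 + 1 : ℚ) = ((2035000 * 362327 + 1 : ℕ) : ℚ) := by norm_num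
  rw [h0]
  refine le_trans h' ?_
  apply List.sum_le_sum
  intro e he
  have hok := List.all_eq_true.1 table_ok e he
  obtain ⟨hp, ht⟩ := tot_le _ _ _ _ _ hok
  simp only [Function.comp]
  refine le_trans Nat.cast_div_le ?_
  apply div_le_div_of_nonneg_right _ (Nat.cast_nonneg _)
  have ht' : ((1000000 * tot W8 e.1 e.2.1 e.2.2 : ℕ) : ℚ) ≤
      ((1000000 * ∑ r ∈ innerRuns W8 362327 e.1, (r.2 - r.1 + e.1) : ℕ) : ℚ) :=
    Nat.cast_le.2 (Nat.mul_le_mul_left _ ht)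
  rw [Nat.cast_mul, Nat.cast_ofNat] at ht'
  rw [Nat.cast_mul, Nat.cast_ofNat]
  refine le_trans ht' (le_of_eq ?_)
  rw [Nat.cast_mul, Nat.cast_ofNat]

/-- `|w₈| = 362327` and every power `(w₈)^k`, `k ≥ 1`, has sum of exponents of runs
greater than `2.035` times its length. -/
theorem w8_powers_sigma_gt :
    w8.length = 362327 ∧
    ∀ k : ℕ, 1 ≤ k →
      sigma ((List.replicate k w8).flatten) >
        (2.035 : ℚ) * (((List.replicate k w8).flatten).length : ℚ) := by
  refine ⟨w8_length, fun k hk => ?_⟩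
  have hps : ∀ p ∈ (table.map fun e => e.1).toFinset, 0 < p := by
    intro p hp
    rw [List.mem_toFinset, List.mem_map] at hp
    obtain ⟨e, he, rfl⟩ := hp
    exact (tot_le _ _ _ _ _ (List.all_eq_true.1 table_ok e he)).1
  have h1 := sigma_ge_s1 W8 362327 w8 w8_length w8_get k _ hps
  have h2 := list_bound
  have hlen : (((List.replicate k w8).flatten).length : ℚ) = k * 362327 := by
    simp [w8_length]
  have hk' : (1 : ℚ) ≤ k := by exact_mod_cast hk
  have e : ∑ p ∈ (table.map fun e => e.1).toFinset,
      (k : ℚ) * ((∑ r ∈ innerRuns W8 362327 p, (r.2 - r.1 + p) : ℕ) : ℚ) / p =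
      (k / 1000000 : ℚ) * ∑ p ∈ (table.map fun e => e.1).toFinset,
        1000000 * ((∑ r ∈ innerRuns W8 362327 p, (r.2 - r.1 + p) : ℕ) : ℚ) / p := by
    rw [Finset.mul_sum]
    apply Finset.sum_congr rfl
    intro p _
    ring
  rw [e] at h1
  have h3 := mul_le_mul_of_nonneg_left h2 (show (0 : ℚ) ≤ k / 1000000 by positivity)
  rw [hlen, gt_iff_lt]
  refine lt_of_lt_of_le ?_ (le_trans h3 h1)
  norm_num
  linarith
end RunsExp
end

section
/- Let v be a run in a word u with shortest period p, let w be the prefix of v of length p, and let w_min and w_max be the lexicographically minimal and maximal words cyclically equivalent to w. If e denotes the exponent of v and k = ⌊e⌋ − 1, then both (w_min)^k and (w_max)^k occur as factors of v. -/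
open scoped Classical

namespace RunsExp

variable {α : Type*}

/-- Letters of a power of a word. -/
theorem flatten_replicate_getElem? (l : List α) (k t : ℕ) (ht : t < k * l.length) :
    (List.replicate k l).flatten[t]? = l[t % l.length]? := by
  induction k generalizing t with
  | zero => simp at ht
  | succ k ih =>
    rw [List.replicate_succ, List.flatten_cons]
    by_cases h : t < l.length
    · rw [List.getElem?_append_left h, Nat.mod_eq_of_lt h]
    · push Not at h
      rw [List.getElem?_append_right h, ih _ (by rw [Nat.succ_mul] at ht; omega)]
      rw [← Nat.mod_eq_sub_mod h]

/-- Letters of a word with period `p`. -/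
theorem period_getElem? (v : List α) (p : ℕ) (hp : IsPeriod v p) (t : ℕ) (ht : t < v.length) :
    v[t]? = v[t % p]? := by
  induction t using Nat.strong_induction_on with
  | _ t ih =>
    by_cases h : t < p
    · rw [Nat.mod_eq_of_lt h]
    · push Not at h
      have h0 := hp.1
      have h1 := hp.2 (t - p) (by omega)
      rw [Nat.sub_add_cancel h] at h1
      rw [← h1, ih (t - p) (by omega) (by omega), ← Nat.mod_eq_sub_mod h]

/-- Powers of rotations of the period prefix are factors. -/
theorem rotate_pow_isInfix (v : List α) (p : ℕ) (hp : IsPeriod v p) (k r : ℕ) (hr : r < p)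
    (hk : (k + 1) * p ≤ v.length) :
    (List.replicate k ((v.take p).rotate r)).flatten <:+: v := by
  have hpv : p ≤ v.length := by nlinarith
  have hlen : ((v.take p).rotate r).length = p := by simp [hpv]
  have hlt : (v.take p).length = p := by simp [hpv]
  have key : (List.replicate k ((v.take p).rotate r)).flatten = (v.drop r).take (k * p) := by
    apply List.ext_getElem?
    intro t
    by_cases ht : t < k * p
    · have hm := Nat.mod_lt t hp.1
      rw [flatten_replicate_getElem? _ _ _ (by rw [hlen]; exact ht), hlen,
        List.getElem?_rotate (by rw [hlt]; exact hm), hlt,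
        List.getElem?_take_of_lt (Nat.mod_lt _ hp.1), List.getElem?_take_of_lt ht,
        List.getElem?_drop, period_getElem? v p hp (r + t) (by rw [Nat.succ_mul] at hk; omega)]
      congr 1
      rw [Nat.mod_add_mod, Nat.add_comm]
    · rw [List.getElem?_eq_none, List.getElem?_eq_none]
      · simp; omega
      · rw [List.length_flatten]
        simp [hpv]; omega
  rw [key]
  exact (List.take_prefix _ _).isInfix.trans (List.drop_suffix _ _).isInfix

/-- A fold by a selecting operation stays in the family. -/
theorem foldr_mem {β : Type*} (f : β → β → β) (hf : ∀ a b, f a b = a ∨ f a b = b)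
    (b : β) (l : List β) : l.foldr f b = b ∨ l.foldr f b ∈ l := by
  induction l with
  | nil => simp
  | cons a l ih =>
    simp only [List.foldr_cons, List.mem_cons]
    rcases hf a (l.foldr f b) with h | h <;> rw [h] <;> tauto

theorem foldr_rotate (f : List α → List α → List α) (hf : ∀ a b, f a b = a ∨ f a b = b)
    (w : List α) (hw : 0 < w.length) :
    ∃ r < w.length, ((List.range w.length).map w.rotate).foldr f w = w.rotate r := by
  rcases foldr_mem f hf w ((List.range w.length).map w.rotate) with h | h
  · exact ⟨0, hw, by simpa using h⟩
  · obtain ⟨r, hr, h⟩ := List.mem_map.1 h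
    exact ⟨r, List.mem_range.1 hr, h.symm⟩

/-- For a run `v = [i..j]` in `u` with shortest period `p` and period-prefix `w`,
both `(w_min)^k` and `(w_max)^k`, where `k = ⌊e⌋ - 1` and `e` is the exponent of the
run, occur as factors of `v`. -/
theorem minRot_pow_isInfix_and_maxRot_pow_isInfix [LinearOrder α] (u : List α)
    (i j : ℕ) (hrun : IsRun u i j)
    (w : List α) (hw : w = factor u i (i + minPeriod (factor u i j) - 1))
    (k : ℕ) (hk : (k : ℤ) = ⌊exponent u i j⌋ - 1) :
    (List.replicate k (minRot w)).flatten <:+: factor u i j ∧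
    (List.replicate k (maxRot w)).flatten <:+: factor u i j := by
  obtain ⟨hij, hju, h2, -, -⟩ := hrun
  have hlen : (factor u i j).length = j - i + 1 := by
    simp only [factor, List.length_take, List.length_drop]; omega
  have hp : IsPeriod (factor u i j) (minPeriod (factor u i j)) := by
    have hne : {p | IsPeriod (factor u i j) p}.Nonempty :=
      ⟨(factor u i j).length, by omega, fun t ht => by omega⟩
    exact Nat.sInf_mem hne
  unfold exponent at hk
  have hwv : w = (factor u i j).take (minPeriod (factor u i j)) := by
    rw [hw]
    generalize minPeriod (factor u i j) = p at *
    have h0 := hp.1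
    unfold factor
    rw [List.take_take]
    congr 1
    omega
  clear hw
  generalize minPeriod (factor u i j) = p at *
  generalize factor u i j = v at *
  have h0 := hp.1
  have hwl : w.length = p := by rw [hwv, List.length_take]; omega
  have hkv : (k + 1) * p ≤ v.length := by
    have h1 : ((k + 1 : ℤ) : ℚ) ≤ ((j : ℚ) - (i : ℚ) + 1) / (p : ℚ) := by
      rw [← Int.le_floor]; omega
    rw [le_div_iff₀ (by exact_mod_cast h0)] at h1
    have h3 : ((k + 1) * p : ℤ) ≤ (j : ℤ) - i + 1 := by exact_mod_cast h1
    rw [hlen]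
    zify [hij]
    exact h3
  constructor
  · obtain ⟨r, hr, h⟩ := foldr_rotate min (fun a b => min_choice a b) w (by omega)
    rw [minRot, h, hwv]
    exact rotate_pow_isInfix v p hp k r (by omega) hkv
  · obtain ⟨r, hr, h⟩ := foldr_rotate max (fun a b => max_choice a b) w (by omega)
    rw [maxRot, h, hwv]
    exact rotate_pow_isInfix v p hp k r (by omega) hkv
end RunsExp
end

section
/- If v₁ and v₂ are two distinct runs in a word u, then their sets of handles are disjoint: H(v₁) ∩ H(v₂) = ∅. -/
open scoped Classical

namespace RunsExp

variable {α : Type*}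

theorem getElem?_factor (u : List α) (i j n : ℕ) (h : n < j - i + 1) :
    (factor u i j)[n]? = u[i + n]? := by
  unfold factor
  rw [List.getElem?_take_of_lt h, List.getElem?_drop]

theorem length_factor (u : List α) (i j : ℕ) (h : i ≤ j) (hj : j < u.length) :
    (factor u i j).length = j - i + 1 := by
  unfold factor
  rw [List.length_take, List.length_drop]
  omega

theorem minPeriod_isPeriod (w : List α) : IsPeriod w (minPeriod w) := by
  have : (minPeriod w) ∈ {p | IsPeriod w p} := by
    apply Nat.sInf_mem
    exact ⟨w.length + 1, by omega, fun i hi => by omega⟩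
  exact this

theorem minPeriod_le (w : List α) (p : ℕ) (h : IsPeriod w p) : minPeriod w ≤ p :=
  Nat.sInf_le h

theorem foldr_min_spec {β : Type*} [LinearOrder β] (w : β) (l : List β) :
    (l.foldr min w = w ∨ l.foldr min w ∈ l) ∧ ∀ x ∈ l, l.foldr min w ≤ x := by
  induction l with
  | nil => simp
  | cons a l ih =>
    obtain ⟨h1, h2⟩ := ih
    simp only [List.foldr_cons, List.mem_cons]
    constructor
    · rcases min_choice a (l.foldr min w) with h | h
      · right; left; exact h
      · rw [h]; tauto
    · rintro x (rfl | hx)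
      · exact min_le_left _ _
      · exact (min_le_right _ _).trans (h2 x hx)

theorem foldr_max_spec {β : Type*} [LinearOrder β] (w : β) (l : List β) :
    (l.foldr max w = w ∨ l.foldr max w ∈ l) ∧ ∀ x ∈ l, x ≤ l.foldr max w := by
  induction l with
  | nil => simp
  | cons a l ih =>
    obtain ⟨h1, h2⟩ := ih
    simp only [List.foldr_cons, List.mem_cons]
    constructor
    · rcases max_choice a (l.foldr max w) with h | h
      · right; left; exact h
      · rw [h]; tauto
    · rintro x (rfl | hx)
      · exact le_max_left _ _
      · exact (h2 x hx).trans (le_max_right _ _)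

theorem rotate_mem (w : List α) (hw : 0 < w.length) (m : ℕ) :
    w.rotate m ∈ (List.range w.length).map w.rotate := by
  rw [← List.rotate_mod]
  exact List.mem_map_of_mem (List.mem_range.2 (Nat.mod_lt _ hw))

theorem minRot_spec [LinearOrder α] (w : List α) (hw : 0 < w.length) :
    (∃ m, minRot w = w.rotate m) ∧ ∀ m, minRot w ≤ w.rotate m := by
  obtain ⟨h1, h2⟩ := foldr_min_spec w ((List.range w.length).map w.rotate)
  refine ⟨?_, fun m => h2 _ (rotate_mem w hw m)⟩
  rcases h1 with h | h
  · exact ⟨0, by rw [List.rotate_zero]; exact h⟩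
  · obtain ⟨m, _, hm⟩ := List.mem_map.1 h
    exact ⟨m, hm.symm⟩

theorem maxRot_spec [LinearOrder α] (w : List α) (hw : 0 < w.length) :
    (∃ m, maxRot w = w.rotate m) ∧ ∀ m, w.rotate m ≤ maxRot w := by
  obtain ⟨h1, h2⟩ := foldr_max_spec w ((List.range w.length).map w.rotate)
  refine ⟨?_, fun m => h2 _ (rotate_mem w hw m)⟩
  rcases h1 with h | h
  · exact ⟨0, by rw [List.rotate_zero]; exact h⟩
  · obtain ⟨m, _, hm⟩ := List.mem_map.1 h
    exact ⟨m, hm.symm⟩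

theorem append_lt_of_length_eq [LinearOrder α] (b : List α) : ∀ (y z : List α),
    y.length = z.length → y < z → y ++ b < z ++ b
  | [], [], _, h => absurd h (lt_irrefl _)
  | [], _ :: _, h, _ => by simp at h
  | _ :: _, [], h, _ => by simp at h
  | c :: y, d :: z, hl, h => by
    rw [List.cons_append, List.cons_append, List.cons_lt_cons_iff]
    rw [List.cons_lt_cons_iff] at h
    rcases h with h | ⟨h, h'⟩
    · exact Or.inl h
    · exact Or.inr ⟨h, append_lt_of_length_eq b y z (by simpa using hl) h'⟩

/-- A bordered word that is extremal among its rotations is equal to a rotation of itself. -/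
theorem rotate_eq_of_border [LinearOrder α] (x : List α)
    (hx : (∀ m, x ≤ x.rotate m) ∨ (∀ m, x.rotate m ≤ x)) (n : ℕ) (hb : n ≤ x.length)
    (hbord : x.take n = x.drop (x.length - n)) : x.rotate n = x := by
  obtain ⟨b, hbdef⟩ : ∃ b, b = x.take n := ⟨_, rfl⟩
  obtain ⟨y, hy⟩ : ∃ y, y = x.drop n := ⟨_, rfl⟩
  obtain ⟨z, hz⟩ : ∃ z, z = x.take (x.length - n) := ⟨_, rfl⟩
  have e1 : x = b ++ y := by rw [hbdef, hy, List.take_append_drop]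
  have e2 : x = z ++ b := by rw [hbdef, hbord, hz, List.take_append_drop]
  have lyz : y.length = z.length := by
    rw [hy, hz, List.length_drop, List.length_take]; omega
  have r1 : x.rotate n = y ++ b := by
    rw [List.rotate_eq_drop_append_take hb, hy, hbdef]
  have r2 : x.rotate (x.length - n) = b ++ z := by
    rw [List.rotate_eq_drop_append_take (by omega), ← hbord, hz, hbdef]
  have key : y = z := by
    rcases hx with hx | hx
    · have h1 := hx n
      have h2 := hx (x.length - n)
      rw [r1] at h1
      rw [r2] at h2
      rcases lt_trichotomy y z with h | h | h
      · have := append_lt_of_length_eq b y z lyz h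
        rw [← e2] at this
        exact absurd h1 (not_le.2 this)
      · exact h
      · have : b ++ z < b ++ y := List.append_left_lt h
        rw [← e1] at this
        exact absurd h2 (not_le.2 this)
    · have h1 := hx n
      have h2 := hx (x.length - n)
      rw [r1] at h1
      rw [r2] at h2
      rcases lt_trichotomy y z with h | h | h
      · have : b ++ y < b ++ z := List.append_left_lt h
        rw [← e1] at this
        exact absurd h2 (not_le.2 this)
      · exact h
      · have := append_lt_of_length_eq b z y lyz.symm h
        rw [← e2] at this
        exact absurd h1 (not_le.2 this)
  rw [r1, key, ← e2]

theorem run_facts (u : List α) (i j : ℕ) (h : IsRun u i j) (p : ℕ)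
    (hp : p = minPeriod (factor u i j)) :
    0 < p ∧ i + 2 * p ≤ j + 1 ∧ j < u.length ∧
    (∀ n, i ≤ n → n + p ≤ j → u[n]? = u[n + p]?) ∧
    (∀ q, 0 < q → (∀ n, i ≤ n → n + q ≤ j → u[n]? = u[n + q]?) → p ≤ q) := by
  obtain ⟨hij, hj, h2, -, -⟩ := h
  rw [← hp] at h2
  obtain ⟨h0, hper⟩ := minPeriod_isPeriod (factor u i j)
  rw [← hp] at h0 hper
  rw [length_factor u i j hij hj] at hper
  refine ⟨h0, by omega, hj, ?_, ?_⟩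
  · intro n hn hnp
    have := hper (n - i) (by omega)
    rw [getElem?_factor _ _ _ _ (by omega), getElem?_factor _ _ _ _ (by omega)] at this
    rwa [show i + (n - i) = n by omega, show i + (n - i + p) = n + p by omega] at this
  · intro q hq hqq
    rw [hp]
    apply minPeriod_le
    refine ⟨hq, fun n hn => ?_⟩
    rw [length_factor u i j hij hj] at hn
    rw [getElem?_factor _ _ _ _ (by omega), getElem?_factor _ _ _ _ (by omega)]
    rw [hqq (i + n) (by omega) (by omega), Nat.add_assoc]

theorem run_primitive (u : List α) (i j : ℕ) (h : IsRun u i j) (p : ℕ)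
    (hp : p = minPeriod (factor u i j)) (b : ℕ) (hb : 0 < b) (hbp : b < p) :
    (factor u i (i + p - 1)).rotate b ≠ factor u i (i + p - 1) := by
  intro hrot
  obtain ⟨h0, h2, hj, hper, hmin⟩ := run_facts u i j h p hp
  have hlen : (factor u i (i + p - 1)).length = p := by
    rw [length_factor _ _ _ (by omega) (by omega)]; omega
  obtain ⟨w, hw⟩ : ∃ w, w = factor u i (i + p - 1) := ⟨_, rfl⟩
  have hwget : ∀ t, t < p → w[t]? = u[i + t]? := fun t ht => by
    rw [hw, getElem?_factor _ _ _ _ (by omega)]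
  rw [← hw] at hrot hlen
  have hmod : ∀ t, i + t ≤ j → u[i + t]? = w[t % p]? := by
    intro t
    induction t using Nat.strong_induction_on with
    | _ t ih =>
      intro ht
      by_cases htp : t < p
      · rw [Nat.mod_eq_of_lt htp, hwget t htp]
      · have e := ih (t - p) (by omega) (by omega)
        rw [Nat.mod_eq_sub_mod (by omega), ← e, hper (i + (t - p)) (by omega) (by omega)]
        congr 1
        omega
  have : p ≤ b := by
    apply hmin b hb
    intro n hn hnb
    obtain ⟨t, rfl⟩ := Nat.exists_eq_add_of_le hn
    rw [hmod t (by omega), Nat.add_assoc, hmod (t + b) (by omega)]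
    have hlt : t % p < p := Nat.mod_lt _ h0
    have := List.getElem?_rotate (l := w) (n := b) (m := t % p) (by omega)
    rw [hrot, hlen] at this
    rw [this, Nat.mod_add_mod]
  omega

/-- An occurrence pair of an unbordered rotation gives a local period. -/
theorem consec_spec [LinearOrder α] (u : List α) (i j : ℕ) (h : IsRun u i j) (p : ℕ)
    (hp : p = minPeriod (factor u i j)) (x : List α)
    (hrot : ∃ m, x = (factor u i (i + p - 1)).rotate m)
    (hx : (∀ m, x ≤ x.rotate m) ∨ (∀ m, x.rotate m ≤ x)) (s s' : ℕ)
    (hc : ConsecutiveOcc u i j x s s') :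
    i + p ≤ s' ∧ s' + p ≤ j + 1 ∧
      ∀ b, 0 < b → b < p → ¬ ∀ t, t < b → u[s' + t]? = u[s' + t - b]? := by
  obtain ⟨h0, h2, hj, hper, hmin⟩ := run_facts u i j h p hp
  have hlenw : (factor u i (i + p - 1)).length = p := by
    rw [length_factor _ _ _ (by omega) (by omega)]; omega
  obtain ⟨m, hm⟩ := hrot
  have hlen : x.length = p := by rw [hm, List.length_rotate, hlenw]
  have hunb : ∀ n, 0 < n → n < p → ¬ ∀ t, t < n → x[t]? = x[t + (p - n)]? := by
    intro n hn hnp hall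
    have hr : x.rotate n = x := by
      apply rotate_eq_of_border x hx n (by omega)
      apply List.ext_getElem?
      intro t
      by_cases ht : t < n
      · rw [List.getElem?_take_of_lt ht, List.getElem?_drop, hall t ht, hlen, Nat.add_comm]
      · rw [List.getElem?_eq_none (by rw [List.length_take]; omega),
          List.getElem?_eq_none (by rw [List.length_drop]; omega)]
    apply run_primitive u i j h p hp n hn hnp
    rw [hm, List.rotate_rotate, Nat.add_comm m n, ← List.rotate_rotate] at hr
    exact List.rotate_injective m hr
  obtain ⟨⟨a1, a2, a3⟩, ⟨b1, b2, b3⟩, hss, hno⟩ := hc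
  have hs : ∀ t, t < p → u[s + t]? = x[t]? := fun t ht => by
    conv_rhs => rw [← a3]
    rw [getElem?_factor _ _ _ _ (by omega)]
  have hs' : ∀ t, t < p → u[s' + t]? = x[t]? := fun t ht => by
    conv_rhs => rw [← b3]
    rw [getElem?_factor _ _ _ _ (by omega)]
  have hge : s + p ≤ s' := by
    by_contra hlt
    apply hunb (p - (s' - s)) (by omega) (by omega)
    intro t ht
    rw [← hs' t (by omega), ← hs _ (by omega)]
    congr 1
    omega
  have hle : s' ≤ s + p := by
    by_contra hlt
    apply hno (s + p) (by omega) (by omega)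
    refine ⟨by omega, by omega, ?_⟩
    conv_rhs => rw [← a3]
    apply List.ext_getElem?
    intro t
    by_cases ht : t < p
    · rw [getElem?_factor _ _ _ _ (by omega), getElem?_factor _ _ _ _ (by omega),
        hper (s + t) (by omega) (by omega)]
      congr 1
      omega
    · rw [List.getElem?_eq_none (by rw [length_factor _ _ _ (by omega) (by omega)]; omega),
          List.getElem?_eq_none (by rw [length_factor _ _ _ (by omega) (by omega)]; omega)]
  refine ⟨by omega, by omega, ?_⟩
  intro b hb hbp hall
  apply hunb b hb hbp
  intro t ht
  rw [← hs' t (by omega), ← hs _ (by omega), hall t ht]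
  congr 1
  omega

theorem handle_spec [LinearOrder α] (u : List α) (i j : ℕ) (h : IsRun u i j) (p : ℕ)
    (hp : p = minPeriod (factor u i j)) (k : ℕ) (hk : k ∈ handles u i j) :
    i + p ≤ k + 1 ∧ k + p ≤ j ∧
      ∀ b, 0 < b → b < p → ¬ ∀ t, t < b → u[k + 1 + t]? = u[k + 1 + t - b]? := by
  obtain ⟨h0, h2, hj, hper, hmin⟩ := run_facts u i j h p hp
  have hlenw : (factor u i (i + p - 1)).length = p := by
    rw [length_factor _ _ _ (by omega) (by omega)]; omega
  obtain ⟨⟨m1, hm1⟩, hmin1⟩ := minRot_spec (factor u i (i + p - 1)) (by omega)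
  obtain ⟨⟨m2, hm2⟩, hmax2⟩ := maxRot_spec (factor u i (i + p - 1)) (by omega)
  unfold handles at hk
  simp only [← hp] at hk
  split_ifs at hk with heq
  · have hp1 : p = 1 := by
      by_contra hne
      apply run_primitive u i j h p hp 1 (by omega) (by omega)
      have e1 := le_antisymm (heq ▸ hmax2 1) (hmin1 1)
      have e0 := le_antisymm (heq ▸ hmax2 0) (hmin1 0)
      rw [e1, ← e0, List.rotate_zero]
    obtain ⟨k1, k2⟩ := hk
    exact ⟨by omega, by omega, fun b hb hbp => by omega⟩
  · obtain ⟨s, s', hc, rfl⟩ := hk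
    have : i + p ≤ s' ∧ s' + p ≤ j + 1 ∧
      ∀ b, 0 < b → b < p → ¬ ∀ t, t < b → u[s' + t]? = u[s' + t - b]? := by
      rcases hc with hc | hc
      · refine consec_spec u i j h p hp _ ⟨m1, hm1⟩ (Or.inl fun m => ?_) s s' hc
        have := hmin1 (m1 + m)
        rwa [← List.rotate_rotate, ← hm1] at this
      · refine consec_spec u i j h p hp _ ⟨m2, hm2⟩ (Or.inr fun m => ?_) s s' hc
        have := hmax2 (m2 + m)
        rwa [← List.rotate_rotate, ← hm2] at this
    obtain ⟨c1, c2, c3⟩ := this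
    rw [show s' - 1 + 1 = s' by omega]
    exact ⟨c1, by omega, c3⟩

theorem handle_period_le [LinearOrder α] (u : List α) (i₁ j₁ i₂ j₂ k : ℕ)
    (h₁ : IsRun u i₁ j₁) (h₂ : IsRun u i₂ j₂)
    (k₁ : k ∈ handles u i₁ j₁) (k₂ : k ∈ handles u i₂ j₂) :
    minPeriod (factor u i₂ j₂) ≤ minPeriod (factor u i₁ j₁) := by
  obtain ⟨h0, h2, hj, hper, hmin⟩ := run_facts u i₁ j₁ h₁ _ rfl
  obtain ⟨a1, a2, -⟩ := handle_spec u i₁ j₁ h₁ _ rfl k k₁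
  obtain ⟨b1, b2, b3⟩ := handle_spec u i₂ j₂ h₂ _ rfl k k₂
  by_contra hlt
  apply b3 (minPeriod (factor u i₁ j₁)) h0 (by omega)
  intro t ht
  rw [hper (k + 1 + t - minPeriod (factor u i₁ j₁)) (by omega) (by omega)]
  congr 1
  omega

/-- Two runs of equal period with long overlap: the left ends compare. -/
theorem run_left_le (u : List α) (i₁ j₁ i₂ j₂ p k : ℕ)
    (h₁ : IsRun u i₁ j₁) (h₂ : IsRun u i₂ j₂)
    (hp₁ : p = minPeriod (factor u i₁ j₁)) (hp₂ : p = minPeriod (factor u i₂ j₂))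
    (a2 : k + p ≤ j₁) (b1 : i₂ + p ≤ k + 1) :
    i₂ ≤ i₁ := by
  obtain ⟨h0, h2, hj, hper, hmin⟩ := run_facts u i₁ j₁ h₁ p hp₁
  obtain ⟨-, -, -, hl, -⟩ := h₂
  rw [← hp₂] at hl
  by_contra hlt
  rcases hl with hl | hl
  · omega
  · apply hl
    rw [hper (i₂ - 1) (by omega) (by omega)]
    congr 1
    omega

theorem run_right_le (u : List α) (i₁ j₁ i₂ j₂ p k : ℕ)
    (h₁ : IsRun u i₁ j₁) (h₂ : IsRun u i₂ j₂)
    (hp₁ : p = minPeriod (factor u i₁ j₁)) (hp₂ : p = minPeriod (factor u i₂ j₂))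
    (a1 : i₁ + p ≤ k + 1) (b2 : k + p ≤ j₂) :
    j₁ ≤ j₂ := by
  obtain ⟨h0, h2, hj, hper, hmin⟩ := run_facts u i₁ j₁ h₁ p hp₁
  obtain ⟨-, -, -, -, hr⟩ := h₂
  rw [← hp₂] at hr
  by_contra hlt
  rcases hr with hr | hr
  · omega
  · apply hr
    rw [hper (j₂ - p + 1) (by omega) (by omega)]
    congr 1
    omega

/-- Handles of distinct runs are disjoint. -/
theorem handles_disjoint [LinearOrder α] (u : List α) (i₁ j₁ i₂ j₂ : ℕ)
    (h₁ : IsRun u i₁ j₁) (h₂ : IsRun u i₂ j₂) (hne : (i₁, j₁) ≠ (i₂, j₂)) :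
    handles u i₁ j₁ ∩ handles u i₂ j₂ = ∅ := by
  rw [Set.eq_empty_iff_forall_notMem]
  rintro k ⟨k₁, k₂⟩
  apply hne
  obtain ⟨p, hp₁⟩ : ∃ p, p = minPeriod (factor u i₁ j₁) := ⟨_, rfl⟩
  have hp₂ : p = minPeriod (factor u i₂ j₂) := by
    rw [hp₁]
    exact le_antisymm (handle_period_le u i₂ j₂ i₁ j₁ k h₂ h₁ k₂ k₁)
      (handle_period_le u i₁ j₁ i₂ j₂ k h₁ h₂ k₁ k₂)
  obtain ⟨a1, a2, -⟩ := handle_spec u i₁ j₁ h₁ p hp₁ k k₁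
  obtain ⟨b1, b2, -⟩ := handle_spec u i₂ j₂ h₂ p hp₂ k k₂
  have e1 : i₁ = i₂ := le_antisymm
    (run_left_le u i₂ j₂ i₁ j₁ p k h₂ h₁ hp₂ hp₁ b2 a1)
    (run_left_le u i₁ j₁ i₂ j₂ p k h₁ h₂ hp₁ hp₂ a2 b1)
  have e2 : j₁ = j₂ := le_antisymm
    (run_right_le u i₁ j₁ i₂ j₂ p k h₁ h₂ hp₁ hp₂ a1 b2)
    (run_right_le u i₂ j₂ i₁ j₁ p k h₂ h₁ hp₂ hp₁ b1 a2)
  rw [e1, e2]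

end RunsExp
end
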